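/- Let ξ ∈ S be pure with W := K_ξ, and let A ∈ so(V, g). Then there exists T ∈ End(S) satisfying T ∘ ρ(x) − ρ(x) ∘ T = ρ(A x) for all x ∈ V, and any two such T differ by a scalar multiple of the identity. Moreover, for any such T one has T(ξ) ∈ span{ξ} if and only if A(W) ⊆ W; that is, the stabiliser in so(V, g) of the pure spinor line span{ξ} under the spin action is exactly the parabolic subalgebra {A ∈ so(V, g) : A(W) ⊆ W}. -/

import Mathlib

noncomputable section

open scoped TensorProduct

/-- The `(2m+1)`-dimensional space `V := N × N* × ℂ`. -/
abbrev Vsp (N : Type) [AddCommGroup N] [Module ℂ N] : Type := N × (N →ₗ[ℂ] ℂ) × ℂ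

/-- The bilinear map `B((v,φ,t),(v',φ',t')) = φ(v') − t·t'`, whose diagonal is `Q`. -/
def Bform (N : Type) [AddCommGroup N] [Module ℂ N] : Vsp N →ₗ[ℂ] Vsp N →ₗ[ℂ] ℂ :=
  LinearMap.mk₂ ℂ (fun x y => x.2.1 y.1 - x.2.2 * y.2.2)
    (fun x x' y => by simp only [Prod.fst_add, Prod.snd_add, LinearMap.add_apply]; ring)
    (fun c x y => by
      simp only [Prod.smul_fst, Prod.smul_snd, LinearMap.smul_apply, smul_eq_mul]; ring)
    (fun x y y' => by simp only [Prod.fst_add, Prod.snd_add, map_add]; ring)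
    (fun c x y => by simp only [Prod.smul_fst, Prod.smul_snd, map_smul, smul_eq_mul]; ring)

/-- The quadratic form `Q(v, φ, t) := φ(v) − t²`. -/
def Qform (N : Type) [AddCommGroup N] [Module ℂ N] : QuadraticForm ℂ (Vsp N) :=
  LinearMap.BilinMap.toQuadraticMap (Bform N)

/-- The polar form `g(x,y) := (Q(x+y) − Q(x) − Q(y))/2`. -/
def gform (N : Type) [AddCommGroup N] [Module ℂ N] (x y : Vsp N) : ℂ :=
  (Qform N (x + y) - Qform N x - Qform N y) / 2

/-- `σ` : the involution acting on `⋀^k N` as `(−1)^(m−k)`. -/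
def sigmaMap (m : ℕ) (N : Type) [AddCommGroup N] [Module ℂ N] :
    ExteriorAlgebra ℂ N →ₗ[ℂ] ExteriorAlgebra ℂ N :=
  ((-1 : ℂ) ^ m) • (CliffordAlgebra.involute (Q := (0 : QuadraticForm ℂ N))).toLinearMap

/-- `ρ(v, φ, t)(ξ) := v ∧ ξ − ι_φ(ξ) + t·σ(ξ)`. -/
def rho (m : ℕ) (N : Type) [AddCommGroup N] [Module ℂ N] :
    Vsp N →ₗ[ℂ] ExteriorAlgebra ℂ N →ₗ[ℂ] ExteriorAlgebra ℂ N :=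
  (LinearMap.mul ℂ (ExteriorAlgebra ℂ N) ∘ₗ ExteriorAlgebra.ι ℂ ∘ₗ
      LinearMap.fst ℂ N ((N →ₗ[ℂ] ℂ) × ℂ))
  - (CliffordAlgebra.contractLeft (Q := (0 : QuadraticForm ℂ N)) ∘ₗ
      LinearMap.fst ℂ (N →ₗ[ℂ] ℂ) ℂ ∘ₗ LinearMap.snd ℂ N ((N →ₗ[ℂ] ℂ) × ℂ))
  + (LinearMap.toSpanSingleton ℂ (ExteriorAlgebra ℂ N →ₗ[ℂ] ExteriorAlgebra ℂ N)
        (sigmaMap m N) ∘ₗ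
      LinearMap.snd ℂ (N →ₗ[ℂ] ℂ) ℂ ∘ₗ LinearMap.snd ℂ N ((N →ₗ[ℂ] ℂ) × ℂ))

/-- `K_ξ := {x ∈ V : ρ(x)(ξ) = 0}`. -/
def Kker (m : ℕ) (N : Type) [AddCommGroup N] [Module ℂ N] (ξ : ExteriorAlgebra ℂ N) :
    Submodule ℂ (Vsp N) :=
  LinearMap.ker ((rho m N).flip ξ)

/-- The polar form `g` as a bilinear form. -/
def gBilin (N : Type) [AddCommGroup N] [Module ℂ N] : LinearMap.BilinForm ℂ (Vsp N) :=
  (2⁻¹ : ℂ) • (Bform N + (Bform N).flip)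

section SpinorModule

variable {N : Type} [AddCommGroup N] [Module ℂ N]

lemma gBilin_apply (x y : Vsp N) :
    gBilin N x y = (x.2.1 y.1 + y.2.1 x.1 - 2 * (x.2.2 * y.2.2)) / 2 := by
  simp only [gBilin, Bform, LinearMap.smul_apply, LinearMap.add_apply, LinearMap.flip_apply,
    LinearMap.mk₂_apply, smul_eq_mul]
  ring

lemma gform_eq_gBilin (x y : Vsp N) : gform N x y = gBilin N x y := by
  simp only [gform, gBilin, Qform, LinearMap.BilinMap.toQuadraticMap_apply, map_add,
    LinearMap.smul_apply, LinearMap.add_apply, LinearMap.flip_apply, smul_eq_mul]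
  ring

lemma gBilin_isSymm : (gBilin N).IsSymm := ⟨fun x y => by
  simp only [gBilin_apply]; ring⟩

lemma gBilin_nondegenerate [FiniteDimensional ℂ N] : (gBilin N).Nondegenerate := by
  have hrefl : LinearMap.IsRefl (gBilin N) := gBilin_isSymm.isRefl
  refine hrefl.nondegenerate_iff_separatingLeft.mpr fun x hx => ?_
  simp only [gBilin_apply] at hx
  have h₁ : x.1 = 0 := by
    rw [← Module.forall_dual_apply_eq_zero_iff ℂ]
    intro φ
    simpa using hx (0, φ, 0)
  have h₂ : x.2.1 = 0 := LinearMap.ext fun v => by simpa using hx (v, 0, 0)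
  have h₃ : x.2.2 = 0 := by simpa using hx (0, 0, 1)
  exact Prod.ext h₁ (Prod.ext h₂ h₃)

lemma involute_contractLeft (φ : N →ₗ[ℂ] ℂ) (s : CliffordAlgebra (0 : QuadraticForm ℂ N)) :
    CliffordAlgebra.involute (CliffordAlgebra.contractLeft φ s) =
      -CliffordAlgebra.contractLeft φ (CliffordAlgebra.involute s) := by
  induction s using CliffordAlgebra.left_induction with
  | algebraMap r => simp
  | add x y hx hy => simp only [map_add, hx, hy, neg_add]
  | ι_mul x v hx =>
    simp only [CliffordAlgebra.contractLeft_ι_mul, map_sub, map_smul, map_mul,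
      CliffordAlgebra.involute_ι, hx, neg_mul, map_neg, mul_neg]
    abel

variable (m : ℕ)

lemma rho_apply (x : Vsp N) (s : ExteriorAlgebra ℂ N) :
    rho m N x s = ExteriorAlgebra.ι ℂ x.1 * s
      - CliffordAlgebra.contractLeft (Q := (0 : QuadraticForm ℂ N)) x.2.1 s
      + x.2.2 • sigmaMap m N s := rfl

lemma mem_Kker {ξ : ExteriorAlgebra ℂ N} {x : Vsp N} : x ∈ Kker m N ξ ↔ rho m N x ξ = 0 :=
  Iff.rfl

lemma sigmaMap_ι_mul (v : N) (s : ExteriorAlgebra ℂ N) :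
    sigmaMap m N (ExteriorAlgebra.ι ℂ v * s) = -(ExteriorAlgebra.ι ℂ v * sigmaMap m N s) := by
  have h : CliffordAlgebra.involute (Q := (0 : QuadraticForm ℂ N)) (ExteriorAlgebra.ι ℂ v) =
    -ExteriorAlgebra.ι ℂ v := CliffordAlgebra.involute_ι v
  simp only [sigmaMap, LinearMap.smul_apply, AlgHom.toLinearMap_apply]
  erw [map_mul, h]
  rw [neg_mul, smul_neg, mul_smul_comm]

lemma sigmaMap_contractLeft (φ : N →ₗ[ℂ] ℂ) (s : ExteriorAlgebra ℂ N) :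
    sigmaMap m N (CliffordAlgebra.contractLeft (Q := (0 : QuadraticForm ℂ N)) φ s) =
      -CliffordAlgebra.contractLeft (Q := (0 : QuadraticForm ℂ N)) φ (sigmaMap m N s) := by
  simp only [sigmaMap, LinearMap.smul_apply, AlgHom.toLinearMap_apply]
  erw [involute_contractLeft, map_smul]
  rw [smul_neg]

lemma sigmaMap_sigmaMap (s : ExteriorAlgebra ℂ N) : sigmaMap m N (sigmaMap m N s) = s := by
  simp only [sigmaMap, LinearMap.smul_apply, AlgHom.toLinearMap_apply]
  erw [map_smul, CliffordAlgebra.involute_involute]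
  rw [smul_smul, ← mul_pow]
  simp

lemma ι_mul_ι_mul_swap (v w : N) (s : ExteriorAlgebra ℂ N) :
    ExteriorAlgebra.ι ℂ v * (ExteriorAlgebra.ι ℂ w * s) =
      -(ExteriorAlgebra.ι ℂ w * (ExteriorAlgebra.ι ℂ v * s)) := by
  rw [← mul_assoc, ← mul_assoc, eq_neg_iff_add_eq_zero, ← add_mul,
    ExteriorAlgebra.ι_add_mul_swap, zero_mul]

/-- The Clifford relation for the spinor representation. -/
lemma rho_mul_add_swap (x y : Vsp N) :
    (rho m N x * rho m N y + rho m N y * rho m N x : Module.End ℂ (ExteriorAlgebra ℂ N)) =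
      (-2 * gBilin N x y) • 1 := by
  refine LinearMap.ext fun s => ?_
  have hι (φ : N →ₗ[ℂ] ℂ) (v : N) (s : ExteriorAlgebra ℂ N) :
      CliffordAlgebra.contractLeft (Q := (0 : QuadraticForm ℂ N)) φ (ExteriorAlgebra.ι ℂ v * s) =
        φ v • s - ExteriorAlgebra.ι ℂ v *
          CliffordAlgebra.contractLeft (Q := (0 : QuadraticForm ℂ N)) φ s :=
    CliffordAlgebra.contractLeft_ι_mul φ v s
  have hφ := CliffordAlgebra.contractLeft_comm (Q := (0 : QuadraticForm ℂ N)) x.2.1 y.2.1 s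
  simp only [LinearMap.add_apply, Module.End.mul_apply, rho_apply, LinearMap.smul_apply,
    Module.End.one_apply, map_add, map_sub, map_smul, sigmaMap_ι_mul, sigmaMap_contractLeft,
    sigmaMap_sigmaMap, hι, gBilin_apply]
  rw [ι_mul_ι_mul_swap x.1 y.1 s]
  erw [hφ]
  module

variable {m}

lemma gBilin_eq_zero_of_mem_Kker {ξ : ExteriorAlgebra ℂ N} (hξ : ξ ≠ 0) {x y : Vsp N}
    (hx : x ∈ Kker m N ξ) (hy : y ∈ Kker m N ξ) : gBilin N x y = 0 := by
  have h := LinearMap.congr_fun (rho_mul_add_swap m x y) ξ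
  rw [mem_Kker] at hx hy
  simpa [hx, hy, hξ] using h

end SpinorModule

/-- Each of finitely many anticommuting square-zero operators with dual partners halves the
dimension of the common kernel. -/
lemma finrank_eq_two_pow_mul_finrank_iInf_ker {K S ι : Type*} [Field K] [AddCommGroup S]
    [Module K S] [FiniteDimensional K S] [DecidableEq ι] (a a' : ι → Module.End K S)
    (haa : ∀ i j, a i * a j = -(a j * a i)) (hsq : ∀ i, a i * a i = 0)
    (haa' : ∀ i j, a i * a' j + a' j * a i = if i = j then 1 else 0) (s : Finset ι) :
    Module.finrank K S =
      2 ^ s.card * Module.finrank K (⨅ i ∈ s, LinearMap.ker (a i) : Submodule K S) := by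
  induction s using Finset.induction_on with
  | empty =>
    have h : (⨅ i ∈ (∅ : Finset ι), LinearMap.ker (a i)) = ⊤ := by simp
    rw [h, finrank_top, Finset.card_empty, pow_zero, one_mul]
  | insert i s his ih =>
    rw [Finset.iInf_insert, Finset.card_insert_of_notMem his, pow_succ, mul_assoc, ih]
    congr 1
    set U : Submodule K S := ⨅ j ∈ s, LinearMap.ker (a j) with hU
    have mem_U (u : S) : u ∈ U ↔ ∀ j ∈ s, a j u = 0 := by simp [hU]
    have hrange : LinearMap.range ((a i).domRestrict U) = LinearMap.ker (a i) ⊓ U := by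
      ext u
      simp only [LinearMap.mem_range, LinearMap.domRestrict_apply, Submodule.mem_inf,
        LinearMap.mem_ker, mem_U]
      constructor
      · rintro ⟨⟨v, hv⟩, rfl⟩
        refine ⟨LinearMap.congr_fun (hsq i) v, fun j hj => ?_⟩
        have h := LinearMap.congr_fun (haa j i) v
        simpa [(mem_U v).mp hv j hj] using h
      · rintro ⟨h₁, h₂⟩
        refine ⟨⟨a' i u, (mem_U _).mpr fun j hj => ?_⟩, ?_⟩
        · have h := LinearMap.congr_fun (haa' j i) u
          have hji : j ≠ i := fun h => his (h ▸ hj)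
          simpa [h₂ j hj, hji] using h
        · simpa [h₁] using LinearMap.congr_fun (haa' i i) u
    have hker : (LinearMap.ker ((a i).domRestrict U)).map U.subtype = LinearMap.ker (a i) ⊓ U := by
      rw [LinearMap.ker_domRestrict, Submodule.map_comap_subtype, inf_comm]
    rw [← LinearMap.finrank_range_add_finrank_ker ((a i).domRestrict U), hrange,
      ← Submodule.finrank_map_subtype_eq, hker, two_mul]

section PureSpinor

variable {N : Type} [AddCommGroup N] [Module ℂ N] [FiniteDimensional ℂ N]

lemma ExteriorAlgebra.finiteDimensional : FiniteDimensional ℂ (ExteriorAlgebra ℂ N) :=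
  (Module.finBasis ℂ N).ExteriorAlgebra.finiteDimensional_of_finite

lemma ExteriorAlgebra.finrank_eq_two_pow :
    Module.finrank ℂ (ExteriorAlgebra ℂ N) = 2 ^ Module.finrank ℂ N := by
  rw [Module.finrank_eq_card_basis (Module.finBasis ℂ N).ExteriorAlgebra]
  simp

variable {m : ℕ}

/-- The spinors annihilated by a maximal isotropic subspace form a line. -/
lemma exists_eq_smul_of_le_Kker (hdim : Module.finrank ℂ N = m) {ξ η : ExteriorAlgebra ℂ N}
    (hξ : ξ ≠ 0) (W : Submodule ℂ (Vsp N)) (hW : Module.finrank ℂ W = m)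
    (hWξ : W ≤ Kker m N ξ) (hWη : W ≤ Kker m N η) : ∃ c : ℂ, η = c • ξ := by
  have := ExteriorAlgebra.finiteDimensional (N := N)
  let b := Module.finBasisOfFinrankEq ℂ W hW
  have hext (i : Fin m) : ∃ x : Vsp N, ∀ j, gBilin N (b j) x = if j = i then -2⁻¹ else 0 := by
    obtain ⟨f, hf⟩ := LinearMap.exists_extend (b.coord i)
    refine ⟨((gBilin N).toDual gBilin_nondegenerate).symm (-(2⁻¹ : ℂ) • f), fun j => ?_⟩
    have hfj : f (b j) = b.coord i (b j) := LinearMap.congr_fun hf (b j)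
    rw [gBilin_isSymm.eq, LinearMap.BilinForm.apply_toDual_symm_apply, LinearMap.smul_apply, hfj]
    simp [Finsupp.single_apply]
  choose w' hw' using hext
  have hiso (i j : Fin m) : gBilin N (b i) (b j) = 0 :=
    gBilin_eq_zero_of_mem_Kker hξ (hWξ (b i).2) (hWξ (b j).2)
  have hanti (i j : Fin m) : rho m N (b i) * rho m N (b j) = -(rho m N (b j) * rho m N (b i)) := by
    rw [eq_neg_iff_add_eq_zero, rho_mul_add_swap, hiso, mul_zero, zero_smul]
  have hsq (i : Fin m) : rho m N (b i) * rho m N (b i) = 0 := by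
    have h := rho_mul_add_swap m (b i : Vsp N) (b i)
    rw [hiso, mul_zero, zero_smul, ← two_smul ℂ] at h
    exact (smul_eq_zero.mp h).resolve_left two_ne_zero
  have hcount := finrank_eq_two_pow_mul_finrank_iInf_ker (fun i => rho m N (b i))
    (fun i => rho m N (w' i)) hanti hsq
    (fun i j => by
      rw [rho_mul_add_swap, hw']
      split_ifs <;> simp) Finset.univ
  rw [ExteriorAlgebra.finrank_eq_two_pow, hdim, Finset.card_univ, Fintype.card_fin] at hcount
  set U : Submodule ℂ (ExteriorAlgebra ℂ N) :=
    ⨅ i ∈ Finset.univ, LinearMap.ker (rho m N (b i)) with hU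
  have hone : Module.finrank ℂ U = 1 :=
    (Nat.mul_left_cancel (by positivity : 0 < 2 ^ m) ((mul_one _).trans hcount)).symm
  have hmem (ζ : ExteriorAlgebra ℂ N) (hζ : W ≤ Kker m N ζ) : ζ ∈ U := by
    simp only [hU, Submodule.mem_iInf, LinearMap.mem_ker]
    exact fun i _ => hζ (b i).2
  obtain ⟨c, hc⟩ := (finrank_eq_one_iff_of_nonzero' (⟨ξ, hmem ξ hWξ⟩ : U)
    (fun h => hξ (congrArg Subtype.val h))).mp hone ⟨η, hmem η hWη⟩
  exact ⟨c, (congrArg Subtype.val hc).symm⟩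

/-- Schur's lemma for the spinor representation. -/
lemma exists_eq_smul_one_of_commute_rho (hdim : Module.finrank ℂ N = m)
    (D : Module.End ℂ (ExteriorAlgebra ℂ N)) (hD : ∀ x s, D (rho m N x s) = rho m N x (D s)) :
    ∃ c : ℂ, D = c • LinearMap.id := by
  let j : (N →ₗ[ℂ] ℂ) →ₗ[ℂ] Vsp N := LinearMap.inr ℂ N _ ∘ₗ LinearMap.inl ℂ _ ℂ
  have hj : Function.Injective j := LinearMap.inr_injective.comp LinearMap.inl_injective
  have hrank : Module.finrank ℂ (LinearMap.range j) = m := by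
    rw [LinearMap.finrank_range_of_inj hj, ← hdim]
    exact Subspace.dual_finrank_eq
  have hvac (φ : N →ₗ[ℂ] ℂ) : rho m N (j φ) 1 = 0 := by
    have h := CliffordAlgebra.contractLeft_one (Q := (0 : QuadraticForm ℂ N)) φ
    rw [rho_apply]
    simp only [j, LinearMap.comp_apply, LinearMap.inr_apply, LinearMap.inl_apply, map_zero,
      zero_mul, zero_smul, add_zero, zero_sub, neg_eq_zero]
    exact h
  obtain ⟨c, hc⟩ := exists_eq_smul_of_le_Kker hdim (ξ := (1 : ExteriorAlgebra ℂ N)) (η := D 1)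
    one_ne_zero (LinearMap.range j) hrank
    (by rintro _ ⟨φ, rfl⟩; exact hvac φ)
    (by rintro _ ⟨φ, rfl⟩; rw [mem_Kker, ← hD, hvac, map_zero])
  have hmul (v : N) (s : ExteriorAlgebra ℂ N) :
      D (ExteriorAlgebra.ι ℂ v * s) = ExteriorAlgebra.ι ℂ v * D s := by
    simpa [rho_apply] using hD (v, 0, 0) s
  refine ⟨c, LinearMap.ext fun s => ?_⟩
  induction s using CliffordAlgebra.left_induction with
  | algebraMap r =>
    have h : D (algebraMap ℂ (ExteriorAlgebra ℂ N) r) =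
        c • algebraMap ℂ (ExteriorAlgebra ℂ N) r := by
      rw [Algebra.algebraMap_eq_smul_one, map_smul, hc, smul_comm]
    exact h
  | add x y hx hy => exact (map_add D x y).trans ((congrArg₂ _ hx hy).trans (map_add _ x y).symm)
  | ι_mul x v hx =>
    have h : D (ExteriorAlgebra.ι ℂ v * x) = c • (ExteriorAlgebra.ι ℂ v * x) := by
      rw [hmul, hx, LinearMap.smul_apply, LinearMap.id_apply, mul_smul_comm]
    exact h

/-- Every skew-adjoint endomorphism of `V` lifts to the spinor space. -/
lemma exists_spin_lift (A : Module.End ℂ (Vsp N))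
    (hA : ∀ x y : Vsp N, gBilin N (A x) y + gBilin N x (A y) = 0) :
    ∃ T : Module.End ℂ (ExteriorAlgebra ℂ N),
      ∀ x : Vsp N, T * rho m N x - rho m N x * T = rho m N (A x) := by
  let e := Module.finBasis ℂ (Vsp N)
  let d := (gBilin N).dualBasis gBilin_nondegenerate e
  have hd (x : Vsp N) : ∑ i, gBilin N (e i) x • d i = x := by
    conv_rhs => rw [← d.sum_repr x]
    refine Finset.sum_congr rfl fun i _ => ?_
    rw [LinearMap.BilinForm.dualBasis_repr_apply, gBilin_isSymm.eq]
  have he (x : Vsp N) : ∑ i, gBilin N (d i) x • e i = x := by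
    have hde : (gBilin N).dualBasis gBilin_nondegenerate d = e :=
      LinearMap.BilinForm.dualBasis_dualBasis _ gBilin_isSymm e
    conv_rhs => rw [← e.sum_repr x]
    refine Finset.sum_congr rfl fun i _ => ?_
    rw [← hde, LinearMap.BilinForm.dualBasis_repr_apply, gBilin_isSymm.eq]
  have hcomm (x y z : Vsp N) :
      (rho m N x * rho m N y * rho m N z - rho m N z * (rho m N x * rho m N y) :
        Module.End ℂ (ExteriorAlgebra ℂ N)) =
        (-2 : ℂ) • rho m N (gBilin N y z • x) + (2 : ℂ) • rho m N (gBilin N x z • y) := by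
    have h : (rho m N x * rho m N y * rho m N z - rho m N z * (rho m N x * rho m N y) :
        Module.End ℂ (ExteriorAlgebra ℂ N)) =
        rho m N x * (rho m N y * rho m N z + rho m N z * rho m N y) -
          (rho m N x * rho m N z + rho m N z * rho m N x) * rho m N y := by
      noncomm_ring
    rw [h, rho_mul_add_swap, rho_mul_add_swap, mul_smul_comm, smul_mul_assoc, mul_one, one_mul,
      map_smul, map_smul]
    module
  refine ⟨(-4⁻¹ : ℂ) • ∑ i, rho m N (A (e i)) * rho m N (d i), fun x => ?_⟩
  have hskew (i) : gBilin N (A (e i)) x • d i = -(gBilin N (e i) (A x) • d i) := by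
    rw [eq_neg_of_add_eq_zero_left (hA (e i) x), neg_smul]
  rw [smul_mul_assoc, mul_smul_comm]
  refine (smul_sub _ _ _).symm.trans ?_
  rw [Finset.sum_mul, Finset.mul_sum, ← Finset.sum_sub_distrib]
  simp only [hcomm, hskew]
  rw [Finset.sum_add_distrib, ← Finset.smul_sum, ← Finset.smul_sum, ← map_sum, ← map_sum,
    Finset.sum_neg_distrib, hd]
  simp only [← map_smul A, ← map_sum A, he]
  rw [map_neg]
  module

end PureSpinor

/-- for `A ∈ so(V,g)` there is a spin lift `T` with
`T ∘ ρ(x) − ρ(x) ∘ T = ρ(Ax)`, unique up to adding a multiple of the identity, and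
for a pure spinor `ξ` with `W = K_ξ` any such `T` preserves the line `⟨ξ⟩` iff
`A(W) ⊆ W`: the stabiliser of `⟨ξ⟩` is the parabolic `{A ∈ so(V,g) : A(W) ⊆ W}`. -/
theorem spin_stabiliser_parabolic
    (m : ℕ) (hm : 0 < m) (N : Type) [AddCommGroup N] [Module ℂ N]
    [FiniteDimensional ℂ N] (hdim : Module.finrank ℂ N = m)
    (ξ : ExteriorAlgebra ℂ N) (hξ0 : ξ ≠ 0)
    (hξ : Module.finrank ℂ (Kker m N ξ) = m)
    (A : Module.End ℂ (Vsp N))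
    (hA : ∀ x y : Vsp N, gform N (A x) y + gform N x (A y) = 0) :
    (∃ T : Module.End ℂ (ExteriorAlgebra ℂ N),
        ∀ x : Vsp N, T ∘ₗ rho m N x - rho m N x ∘ₗ T = rho m N (A x)) ∧
    (∀ T T' : Module.End ℂ (ExteriorAlgebra ℂ N),
        (∀ x : Vsp N, T ∘ₗ rho m N x - rho m N x ∘ₗ T = rho m N (A x)) →
        (∀ x : Vsp N, T' ∘ₗ rho m N x - rho m N x ∘ₗ T' = rho m N (A x)) →
        ∃ c : ℂ, T' = T + c • LinearMap.id) ∧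
    (∀ T : Module.End ℂ (ExteriorAlgebra ℂ N),
        (∀ x : Vsp N, T ∘ₗ rho m N x - rho m N x ∘ₗ T = rho m N (A x)) →
        ((∃ c : ℂ, T ξ = c • ξ) ↔ ∀ w ∈ Kker m N ξ, A w ∈ Kker m N ξ)) := by
  refine ⟨exists_spin_lift A fun x y => ?_, fun T T' hT hT' => ?_, fun T hT => ?_⟩
  · simpa only [gform_eq_gBilin] using hA x y
  · obtain ⟨c, hc⟩ := exists_eq_smul_one_of_commute_rho hdim (T' - T) fun x s => by
      have h := LinearMap.congr_fun ((hT' x).trans (hT x).symm) s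
      simp only [LinearMap.sub_apply, LinearMap.comp_apply] at h
      rw [LinearMap.sub_apply, LinearMap.sub_apply, map_sub, sub_eq_sub_iff_sub_eq_sub, h]
    exact ⟨c, by rw [← hc, add_sub_cancel]⟩
  · have hTξ (w : Vsp N) (hw : w ∈ Kker m N ξ) : rho m N (A w) ξ = -rho m N w (T ξ) := by
      rw [mem_Kker] at hw
      rw [← hT w, LinearMap.sub_apply, LinearMap.comp_apply, LinearMap.comp_apply, hw, map_zero,
        zero_sub]
    constructor
    · rintro ⟨c, hc⟩ w hw
      rw [mem_Kker, hTξ w hw, hc, map_smul, (mem_Kker m).mp hw, smul_zero, neg_zero]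
    · intro hAW
      refine exists_eq_smul_of_le_Kker hdim hξ0 (Kker m N ξ) hξ le_rfl fun w hw => ?_
      rw [mem_Kker, ← neg_eq_zero, ← hTξ w hw]
      exact hAW w hw
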